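/- For every integer m ≥ 0, there exists an optimal Hermitian LCD quaternary [5m+3, 2, 4m+2] code, and any two optimal Hermitian LCD [5m+3, 2, 4m+2] codes are equivalent. -/

import Mathlib

open Finset

/-- The finite field with four elements. -/
abbrev F4 : Type := GaloisField 2 2

noncomputable instance : Fintype F4 := Fintype.ofFinite F4

lemma F4.card_eq : Fintype.card F4 = 4 := by
  simpa using GaloisField.card 2 2 (by norm_num)

lemma F4.exists_omega : ∃ x : F4, x ^ 2 + x + 1 = 0 := by
  classical
  obtain ⟨x, hx0, hx1⟩ : ∃ x : F4, x ≠ 0 ∧ x ≠ 1 := by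
    by_contra h
    push_neg at h
    have hsub : (Finset.univ : Finset F4) ⊆ {0, 1} := by
      intro x _
      rcases eq_or_ne x 0 with h0 | h0
      · simp [h0]
      · simp [h x h0]
    have h1 := Finset.card_le_card hsub
    have h2 : ({0, 1} : Finset F4).card ≤ 2 := (Finset.card_insert_le _ _).trans (by simp)
    have h3 : (Finset.univ : Finset F4).card = 4 := F4.card_eq
    omega
  refine ⟨x, ?_⟩
  have hx : x ^ Fintype.card F4 = x := FiniteField.pow_card x
  rw [F4.card_eq] at hx
  have hmul : x * (x - 1) * (x ^ 2 + x + 1) = 0 := by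
    have : x * (x - 1) * (x ^ 2 + x + 1) = x ^ 4 - x := by ring
    rw [this, hx, sub_self]
  rcases mul_eq_zero.mp hmul with h | h
  · rcases mul_eq_zero.mp h with h | h
    · exact absurd h hx0
    · exact absurd (sub_eq_zero.mp h) hx1
  · exact h

/-- A fixed root of `X² + X + 1` in `F₄`. -/
noncomputable def ω4 : F4 := Classical.choose F4.exists_omega

lemma ω4_spec : ω4 ^ 2 + ω4 + 1 = 0 := Classical.choose_spec F4.exists_omega

open scoped Classical in
/-- Hamming weight of a vector. -/
noncomputable def wt {n : ℕ} (x : Fin n → F4) : ℕ :=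
  (Finset.univ.filter fun i => x i ≠ 0).card

/-- `C` is a code with minimum (nonzero) weight `d`. -/
noncomputable def hasMinWeight {n : ℕ} (C : Submodule F4 (Fin n → F4)) (d : ℕ) : Prop :=
  (∀ x ∈ C, x ≠ 0 → d ≤ wt x) ∧ ∃ x ∈ C, x ≠ 0 ∧ wt x = d

/-- The Hermitian inner product on `F₄ⁿ`; the conjugate of `x` is `x²`. -/
noncomputable def hermInner {n : ℕ} (u v : Fin n → F4) : F4 := ∑ i, u i * (v i) ^ 2

/-- The Hermitian dual code. -/
noncomputable def hermDual {n : ℕ} (C : Submodule F4 (Fin n → F4)) : Submodule F4 (Fin n → F4) where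
  carrier := {x | ∀ y ∈ C, hermInner x y = 0}
  zero_mem' := by intro y hy; simp [hermInner]
  add_mem' := by
    intro a b ha hb y hy
    have := ha y hy
    have := hb y hy
    simp only [hermInner, Pi.add_apply, add_mul, Finset.sum_add_distrib] at *
    simp [*]
  smul_mem' := by
    intro c a ha y hy
    have h := ha y hy
    simp only [hermInner, Pi.smul_apply, smul_eq_mul, mul_assoc, ← Finset.mul_sum] at *
    simp [h]

/-- `C` is a Hermitian linear complementary dual code. -/
noncomputable def IsHermLCD {n : ℕ} (C : Submodule F4 (Fin n → F4)) : Prop :=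
  C ⊓ hermDual C = ⊥

/-- The monomial linear map given by a permutation of coordinates followed by a
multiplication of each coordinate by a scalar. -/
noncomputable def monoMap {n : ℕ} (σ : Equiv.Perm (Fin n)) (s : Fin n → F4) :
    (Fin n → F4) →ₗ[F4] (Fin n → F4) where
  toFun x := fun i => s i * x (σ i)
  map_add' a b := by funext i; simp [mul_add]
  map_smul' c a := by funext i; simp [smul_eq_mul]; ring

/-- Two codes are equivalent if one is obtained from the other by a permutation of the
coordinates and multiplication of coordinates by nonzero scalars. -/
noncomputable def codeEquiv {n : ℕ} (C C' : Submodule F4 (Fin n → F4)) : Prop :=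
  ∃ (σ : Equiv.Perm (Fin n)) (s : Fin n → F4),
    (∀ i, s i ≠ 0) ∧ Submodule.map (monoMap σ s) C = C'

/-- First row of the generator matrix `G(a₁, a₂, a₃, a₄, a₅)`. -/
noncomputable def row1 (n a₁ : ℕ) : Fin n → F4 := fun i =>
  if i.val = 0 then 1
  else if i.val < 2 + a₁ then 0
  else 1

/-- Second row of the generator matrix `G(a₁, a₂, a₃, a₄, a₅)`. -/
noncomputable def row2 (n a₁ a₂ a₃ a₄ : ℕ) : Fin n → F4 := fun i =>
  if i.val = 0 then 0
  else if i.val < 2 + a₁ then 1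
  else if i.val < 2 + a₁ + a₂ then 0
  else if i.val < 2 + a₁ + a₂ + a₃ then 1
  else if i.val < 2 + a₁ + a₂ + a₃ + a₄ then ω4
  else ω4 ^ 2

set_option linter.unusedVariables false in
/-- The code `C(a₁, a₂, a₃, a₄, a₅)`, of length `n = 2 + a₁ + a₂ + a₃ + a₄ + a₅`:
the span of the rows of the generator matrix `G(a₁, a₂, a₃, a₄, a₅)` whose columns are
`(1,0)ᵀ`, `(0,1)ᵀ`, `a₁` columns `(0,1)ᵀ`, `a₂` columns `(1,0)ᵀ`, `a₃` columns `(1,1)ᵀ`,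
`a₄` columns `(1,ω)ᵀ` and `a₅` columns `(1,ω²)ᵀ`. -/
noncomputable def Ccode (n a₁ a₂ a₃ a₄ a₅ : ℕ) : Submodule F4 (Fin n → F4) :=
  Submodule.span F4 {row1 n a₁, row2 n a₁ a₂ a₃ a₄}

/-- The largest minimum weight among Hermitian LCD `[n,2]` codes. -/
def optimalDist (n : ℕ) : ℕ :=
  if n % 5 = 1 ∨ n % 5 = 2 ∨ n % 5 = 3 then 4 * n / 5 else 4 * n / 5 - 1

/-- `C` is an optimal Hermitian LCD `[n, 2, d]` code. -/
noncomputable def IsOptimalLCD (n d : ℕ) (C : Submodule F4 (Fin n → F4)) : Prop :=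
  Module.finrank F4 C = 2 ∧ hasMinWeight C d ∧ IsHermLCD C ∧ d = optimalDist n

/-- The linear map appending a zero coordinate: `x ↦ (x, 0)`. -/
noncomputable def extendZero (m : ℕ) : (Fin m → F4) →ₗ[F4] (Fin (m + 1) → F4) where
  toFun x := Fin.snoc x 0
  map_add' a b := by
    funext i
    refine Fin.lastCases ?_ ?_ i <;> simp
  map_smul' c a := by
    funext i
    refine Fin.lastCases ?_ ?_ i <;> simp

lemma F4.card_univ : (univ : Finset F4).card = 4 := F4.card_eq

lemma F4.pow_four (x : F4) : x ^ 4 = x := by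
  have hx : x ^ Fintype.card F4 = x := FiniteField.pow_card x
  rwa [F4.card_eq] at hx

lemma F4.pow_three {x : F4} (hx : x ≠ 0) : x ^ 3 = 1 :=
  mul_left_cancel₀ hx (by rw [mul_one, ← pow_succ', F4.pow_four])

lemma F4.two_eq_zero : (2 : F4) = 0 := CharTwo.two_eq_zero

lemma ω4_ne_zero : ω4 ≠ 0 := by
  intro h
  simpa [h] using ω4_spec

open scoped Classical in
/-- The number of zero coordinates of a vector. -/
noncomputable def zeroCount {n : ℕ} (x : Fin n → F4) : ℕ := #{i | x i = 0}

lemma zeroCount_add_wt {n : ℕ} (x : Fin n → F4) : zeroCount x + wt x = n := by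
  classical
  simpa [zeroCount, wt] using
    card_filter_add_card_filter_not (s := (univ : Finset (Fin n))) fun i => x i = 0

open scoped Classical in
lemma wt_smul {n : ℕ} {c : F4} (hc : c ≠ 0) (x : Fin n → F4) : wt (c • x) = wt x :=
  congrArg card (filter_congr fun i _ => by simp [hc])

open scoped Classical in
lemma zeroCount_add_sum {n : ℕ} (u v : Fin n → F4) :
    zeroCount u + ∑ x : F4, zeroCount (v - x • u) = n + 4 * #{i | u i = 0 ∧ v i = 0} := by
  have h (i : Fin n) : (if u i = 0 then 1 else 0) + ∑ x : F4, (if v i - x * u i = 0 then 1 else 0)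
      = 1 + 4 * if u i = 0 ∧ v i = 0 then 1 else 0 := by
    by_cases hu : u i = 0
    · by_cases hv : v i = 0 <;> simp [hu, hv, F4.card_eq]
    · have (x : F4) : v i - x * u i = 0 ↔ x = v i / u i := by
        rw [sub_eq_zero, eq_div_iff hu, eq_comm]
      simp [hu, this]
  have hs := Finset.sum_congr (rfl : (univ : Finset (Fin n)) = univ) fun i _ => h i
  rw [sum_add_distrib, sum_comm, sum_add_distrib, ← mul_sum] at hs
  simpa only [zeroCount, card_filter, Pi.sub_apply, Pi.smul_apply, smul_eq_mul, sum_const, card_fin,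
    mul_one] using hs

lemma hermInner_self {n : ℕ} (x : Fin n → F4) : hermInner x x = wt x := by
  classical
  simp only [hermInner, wt, card_filter, Nat.cast_sum]
  refine sum_congr rfl fun i _ => ?_
  by_cases h : x i = 0
  · simp [h]
  · rw [← pow_succ', F4.pow_three h]
    simp [h]

lemma hermInner_add_left {n : ℕ} (u v w : Fin n → F4) :
    hermInner (u + v) w = hermInner u w + hermInner v w := by
  simp [hermInner, add_mul, sum_add_distrib]

lemma hermInner_smul_left {n : ℕ} (c : F4) (u w : Fin n → F4) :
    hermInner (c • u) w = c * hermInner u w := by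
  simp [hermInner, mul_sum, mul_assoc]

lemma hermInner_conj {n : ℕ} (u v : Fin n → F4) : hermInner u v ^ 2 = hermInner v u := by
  simp only [hermInner, CharTwo.sum_sq]
  refine sum_congr rfl fun i _ => ?_
  rw [mul_pow, ← pow_mul, F4.pow_four, mul_comm]

lemma hermInner_add_self {n : ℕ} (u v : Fin n → F4) :
    hermInner (u + v) (u + v)
      = hermInner u u + hermInner v v + (hermInner u v + hermInner u v ^ 2) := by
  rw [hermInner_add_left, ← hermInner_conj (u + v) u, ← hermInner_conj (u + v) v,
    hermInner_add_left, hermInner_add_left, CharTwo.add_sq, CharTwo.add_sq,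
    hermInner_conj, hermInner_conj, hermInner_conj, hermInner_conj]
  ring

lemma hermInner_eq_zero_of_wt {n : ℕ} {u v : Fin n → F4} (hv : Even (wt u + wt v))
    (h : ∀ c : F4, c ≠ 0 → Even (wt (c • u + v))) : hermInner u v = 0 := by
  have key (c : F4) (hc : c ≠ 0) :
      c * hermInner u v + (c * hermInner u v) ^ 2 = 0 := by
    have h1 := hermInner_add_self (c • u) v
    rw [hermInner_self, hermInner_self, hermInner_self, wt_smul hc, ← Nat.cast_add,
      CharTwo.natCast_eq_ite, if_pos (h c hc), CharTwo.natCast_eq_ite,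
      if_pos hv,
      hermInner_smul_left, zero_add] at h1
    exact h1.symm
  have h1 := key 1 one_ne_zero
  have h2 := key ω4 ω4_ne_zero
  linear_combination ω4 ^ 2 * h1 - h2 - hermInner u v * ω4_spec
    + hermInner u v * (1 + ω4) * F4.two_eq_zero

/-- A nonzero Hermitian LCD code contains a codeword of odd weight. -/
lemma IsHermLCD.exists_odd_wt {n : ℕ} {C : Submodule F4 (Fin n → F4)} (hC : IsHermLCD C)
    (hne : C ≠ ⊥) : ∃ x ∈ C, Odd (wt x) := by
  by_contra! h
  simp only [Nat.not_odd_iff_even] at h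
  refine hne (eq_bot_iff.2 (hC ▸ le_inf le_rfl fun x hx y hy => ?_))
  exact hermInner_eq_zero_of_wt ((h x hx).add (h y hy))
    fun c _ => h _ (C.add_mem (C.smul_mem c hx) hy)

lemma exists_perm_of_card_fiber_eq {α β : Type*} [Fintype α] [DecidableEq β] (f g : α → β)
    (h : ∀ b, #{a | f a = b} = #{a | g a = b}) : ∃ σ : Equiv.Perm α, ∀ a, g (σ a) = f a := by
  have e (b : β) : Nonempty ({a // f a = b} ≃ {a // g a = b}) := by
    rw [← Fintype.card_eq, Fintype.card_subtype, Fintype.card_subtype, h]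
  exact ⟨Equiv.ofFiberEquiv fun b => (e b).some, Equiv.ofFiberEquiv_map _⟩

lemma exists_card_fiber_eq {β : Type*} [Fintype β] [DecidableEq β] {n : ℕ} (c : β → ℕ)
    (h : ∑ b, c b = n) : ∃ f : Fin n → β, ∀ b, #{i | f i = b} = c b := by
  have e : Fin n ≃ Σ b, Fin (c b) := (Fintype.equivFinOfCardEq (by simpa using h)).symm
  refine ⟨fun i => (e i).1, fun b => ?_⟩
  rw [← Fintype.card_subtype, ← Fintype.card_fin (c b)]
  exact Fintype.card_congr ((e.subtypeEquiv fun _ => Iff.rfl).trans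
    (Equiv.sigmaSubtype (β := fun b => Fin (c b)) b))

open scoped Classical in
/-- The point of the projective line over `F4` spanned by the `i`-th column of the matrix with
rows `u` and `v`; a zero column is sent to `none`. -/
noncomputable def columnPoint {n : ℕ} (u v : Fin n → F4) (i : Fin n) : Option F4 :=
  if u i = 0 then none else some (v i / u i)

open scoped Classical in
lemma card_columnPoint_eq_none {n : ℕ} (u v : Fin n → F4) :
    #{i | columnPoint u v i = none} = zeroCount u := by
  simp [columnPoint, zeroCount]

open scoped Classical in
lemma card_columnPoint_eq_some {n : ℕ} {u v : Fin n → F4} (huv : ∀ i, ¬(u i = 0 ∧ v i = 0))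
    (x : F4) : #{i | columnPoint u v i = some x} = zeroCount (v - x • u) := by
  refine congrArg card (filter_congr fun i _ => ?_)
  by_cases hu : u i = 0
  · have := huv i
    simp_all [columnPoint]
  · simp [columnPoint, hu, div_eq_iff hu, sub_eq_zero]

open scoped Classical in
lemma codeEquiv_span_pair {n : ℕ} {u v u' v' : Fin n → F4} (huv : ∀ i, ¬(u i = 0 ∧ v i = 0))
    (huv' : ∀ i, ¬(u' i = 0 ∧ v' i = 0)) (hu : zeroCount u = zeroCount u')
    (hv : ∀ x : F4, zeroCount (v - x • u) = zeroCount (v' - x • u')) :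
    codeEquiv (Submodule.span F4 {u, v}) (Submodule.span F4 {u', v'}) := by
  obtain ⟨σ, hσ⟩ := exists_perm_of_card_fiber_eq (columnPoint u' v') (columnPoint u v) (by
    rintro (_ | x)
    · rw [card_columnPoint_eq_none, card_columnPoint_eq_none, hu]
    · rw [card_columnPoint_eq_some huv, card_columnPoint_eq_some huv', hv])
  have hs (i : Fin n) : ∃ s : F4, s ≠ 0 ∧ s * u (σ i) = u' i ∧ s * v (σ i) = v' i := by
    have h := hσ i
    have h1 := huv (σ i)
    have h2 := huv' i
    by_cases hu' : u' i = 0 <;> by_cases hu : u (σ i) = 0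
    · simp only [hu, hu', true_and] at h1 h2 ⊢
      exact ⟨v' i / v (σ i), div_ne_zero h2 h1, by simp, div_mul_cancel₀ _ h1⟩
    · simp [columnPoint, hu, hu'] at h
    · simp [columnPoint, hu, hu'] at h
    · simp only [columnPoint, hu, hu', if_false, Option.some.injEq] at h
      refine ⟨u' i / u (σ i), div_ne_zero hu' hu, div_mul_cancel₀ _ hu, ?_⟩
      rw [div_eq_div_iff hu hu'] at h
      rw [div_mul_eq_mul_div, div_eq_iff hu, mul_comm, h]
  choose s hs0 hsu hsv using hs
  refine ⟨σ, s, hs0, ?_⟩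
  rw [Submodule.map_span, Set.image_pair]
  congr 2
  · exact funext hsu
  · exact congrArg _ (funext hsv)

lemma zeroCount_le_of_hasMinWeight {n d : ℕ} {C : Submodule F4 (Fin n → F4)}
    (h : hasMinWeight C d) {x : Fin n → F4} (hx : x ∈ C) (hx0 : x ≠ 0) :
    zeroCount x + d ≤ n := by
  have := zeroCount_add_wt x
  have := h.1 x hx hx0
  omega

lemma Submodule.exists_eq_span_pair_of_finrank_eq_two {K V : Type*} [Field K] [AddCommGroup V]
    [Module K V] {C : Submodule K V} (hC : Module.finrank K C = 2) {u : V} (hu : u ∈ C)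
    (hu0 : u ≠ 0) : ∃ v, LinearIndependent K ![u, v] ∧ C = Submodule.span K {u, v} := by
  have : FiniteDimensional K C := Module.finite_of_finrank_eq_succ hC
  obtain ⟨v, hv, hvu⟩ : ∃ v ∈ C, v ∉ Submodule.span K {u} := by
    by_contra! h
    have h1 := Submodule.finrank_mono (show C ≤ Submodule.span K {u} from h)
    have h2 := finrank_span_singleton (K := K) hu0
    omega
  have hli : LinearIndependent K ![u, v] := by
    rw [LinearIndependent.pair_iff' hu0]
    rintro a rfl
    exact hvu (Submodule.mem_span_singleton.2 ⟨a, rfl⟩)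
  refine ⟨v, hli, (Submodule.eq_of_le_of_finrank_eq ?_ ?_).symm⟩
  · simp [Submodule.span_le, Set.insert_subset_iff, hu, hv]
  · rw [hC, ← Matrix.range_cons_cons_empty u v ![], finrank_span_eq_card hli, Fintype.card_fin]

lemma span_pair_sub_smul {K V : Type*} [Field K] [AddCommGroup V] [Module K V] (u v : V) (a : K) :
    Submodule.span K {u, v - a • u} = Submodule.span K {u, v} := by
  apply le_antisymm <;> rw [Submodule.span_le, Set.pair_subset_iff] <;>
    refine ⟨Submodule.subset_span (by simp), ?_⟩
  · exact Submodule.mem_span_pair.2 ⟨-a, 1, by module⟩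
  · exact Submodule.mem_span_pair.2 ⟨a, 1, by module⟩

open scoped Classical in
/-- Normal form of an optimal Hermitian LCD `[5m + 3, 2, 4m + 2]` code. -/
lemma IsOptimalLCD.exists_normal_form {m : ℕ} {C : Submodule F4 (Fin (5 * m + 3) → F4)}
    (hC : IsOptimalLCD (5 * m + 3) (4 * m + 2) C) :
    ∃ u v, C = Submodule.span F4 {u, v} ∧ (∀ i, ¬(u i = 0 ∧ v i = 0)) ∧ zeroCount u = m ∧
      ∀ x : F4, zeroCount (v - x • u) = if x = 0 then m else m + 1 := by
  obtain ⟨hrank, hmin, hlcd, -⟩ := hC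
  obtain ⟨u, huC, hodd⟩ := hlcd.exists_odd_wt (by rintro rfl; simp at hrank)
  have hu0 : u ≠ 0 := by
    rintro rfl
    simp [wt] at hodd
  obtain ⟨v, hli, hspan⟩ := Submodule.exists_eq_span_pair_of_finrank_eq_two hrank huC hu0
  have hle (x : F4) : zeroCount (v - x • u) ≤ m + 1 := by
    have := zeroCount_le_of_hasMinWeight hmin (x := v - x • u)
      (hspan ▸ Submodule.mem_span_pair.2 ⟨-x, 1, by module⟩)
      fun h => (LinearIndependent.pair_iff' hu0).1 hli x (sub_eq_zero.1 h).symm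
    omega
  have hule := zeroCount_le_of_hasMinWeight hmin huC hu0
  have hwt := zeroCount_add_wt u
  have hsum := zeroCount_add_sum u v
  have hsum_le : ∑ x : F4, zeroCount (v - x • u) ≤ 4 * (m + 1) := by
    simpa [F4.card_eq] using sum_le_card_nsmul univ _ _ fun x _ => hle x
  have hz : #{i | u i = 0 ∧ v i = 0} = 0 := by omega
  have hum : zeroCount u = m := by
    obtain ⟨k, hk⟩ := hodd
    omega
  obtain ⟨a, ha⟩ : ∃ a : F4, zeroCount (v - a • u) ≤ m := by
    by_contra! h
    have : 4 * (m + 1) ≤ ∑ x : F4, zeroCount (v - x • u) := by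
      simpa [F4.card_eq] using card_nsmul_le_sum univ _ (m + 1) fun x _ => h x
    omega
  have hrest_le : ∀ x ∈ univ.erase a, zeroCount (v - x • u) ≤ m + 1 := fun x _ => hle x
  have hcard : #(univ.erase a) = 3 := by rw [card_erase_of_mem (mem_univ a), F4.card_univ]
  have hrest : ∑ x ∈ univ.erase a, zeroCount (v - x • u) ≤ ∑ x ∈ univ.erase a, (m + 1) :=
    sum_le_sum hrest_le
  have hsplit := add_sum_erase univ (fun x : F4 => zeroCount (v - x • u)) (mem_univ a)
  have heq := (sum_eq_sum_iff_of_le hrest_le).1 (by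
    simp only [sum_const, hcard, smul_eq_mul] at hrest ⊢
    omega)
  have ham : zeroCount (v - a • u) = m := by
    rw [sum_congr rfl heq, sum_const, hcard, smul_eq_mul] at hsplit
    omega
  rw [card_eq_zero, filter_eq_empty_iff] at hz
  refine ⟨u, v - a • u, hspan.trans (span_pair_sub_smul u v a).symm, fun i hi => ?_, hum,
    fun x => ?_⟩
  · exact hz (mem_univ i) ⟨hi.1, by simpa [hi.1] using hi.2⟩
  · rw [sub_sub, ← add_smul]
    split_ifs with hx
    · rw [hx, add_zero, ham]
    · exact heq _ (mem_erase.2 ⟨by simpa using hx, mem_univ _⟩)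

open scoped Classical in
lemma exists_rows_zeroCount {n a : ℕ} (c : F4 → ℕ) (h : a + ∑ x, c x = n) :
    ∃ u v : Fin n → F4, zeroCount u = a ∧ ∀ x : F4, zeroCount (v - x • u) = c x := by
  obtain ⟨f, hf⟩ := exists_card_fiber_eq (fun b : Option F4 => b.elim a c)
    ((Fintype.sum_option _).trans h)
  refine ⟨fun i => (f i).elim 0 fun _ => 1, fun i => (f i).elim 1 id, ?_, fun x => ?_⟩
  · refine (congrArg card (filter_congr fun i _ => ?_)).trans (hf none)
    cases h : f i <;> simp [h]
  · refine (congrArg card (filter_congr fun i _ => ?_)).trans (hf (some x))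
    cases h : f i <;> simp [h, sub_eq_zero]

lemma exists_isOptimalLCD (m : ℕ) :
    ∃ C : Submodule F4 (Fin (5 * m + 3) → F4), IsOptimalLCD (5 * m + 3) (4 * m + 2) C := by
  classical
  have hsum : m + ∑ x : F4, (if x = 0 then m else m + 1) = 5 * m + 3 := by
    have hcard : #(univ.erase (0 : F4)) = 3 := by
      rw [card_erase_of_mem (mem_univ _), F4.card_univ]
    rw [← add_sum_erase univ _ (mem_univ (0 : F4)), if_pos rfl,
      sum_congr rfl fun x hx => if_neg (ne_of_mem_erase hx), sum_const, hcard, smul_eq_mul]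
    ring
  obtain ⟨u, v, hu, hv⟩ := exists_rows_zeroCount _ hsum
  have hwu : wt u = 4 * m + 3 := by have := zeroCount_add_wt u; omega
  have hwv : wt v = 4 * m + 3 := by
    have := zeroCount_add_wt v
    have := hv 0
    simp only [zero_smul, sub_zero, if_true] at this
    omega
  have hwc {c : F4} (hc : c ≠ 0) : wt (v - c • u) = 4 * m + 2 := by
    have := zeroCount_add_wt (v - c • u)
    have := hv c
    rw [if_neg hc] at this
    omega
  have hwge (c : F4) : 4 * m + 2 ≤ wt (v - c • u) := by
    rcases eq_or_ne c 0 with rfl | hc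
    · simp [hwv]
    · rw [hwc hc]
  have hmem {x : Fin (5 * m + 3) → F4} : x ∈ Submodule.span F4 {u, v} ↔
      ∃ a b : F4, a • u + b • v = x := Submodule.mem_span_pair
  have hwt_ge (a b : F4) (h : ¬(a = 0 ∧ b = 0)) : 4 * m + 2 ≤ wt (a • u + b • v) := by
    by_cases hb : b = 0
    · rw [hb, zero_smul, add_zero, wt_smul fun ha => h ⟨ha, hb⟩]
      omega
    · have : a • u + b • v = b • (v - (-(a / b)) • u) := by
        rw [smul_sub, smul_smul, mul_neg, mul_div_cancel₀ _ hb]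
        module
      rw [this, wt_smul hb]
      exact hwge _
  have hwt_zero : wt (0 : Fin (5 * m + 3) → F4) = 0 := by simp [wt]
  have huv : hermInner u v = 0 := by
    refine hermInner_eq_zero_of_wt (by rw [hwu, hwv]; exact ⟨4 * m + 3, rfl⟩) fun c hc => ?_
    have := hwc (neg_ne_zero.2 hc)
    rw [neg_smul, sub_neg_eq_add, add_comm v] at this
    exact ⟨2 * m + 1, by omega⟩
  have hself {w : Fin (5 * m + 3) → F4} (hw : wt w = 4 * m + 3) : hermInner w w = 1 := by
    rw [hermInner_self, hw, CharTwo.natCast_eq_ite, if_neg]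
    exact Nat.not_even_iff_odd.2 ⟨2 * m + 1, by ring⟩
  refine ⟨Submodule.span F4 {u, v}, ?_, ⟨?_, v - (1 : F4) • u, ?_, ?_, hwc one_ne_zero⟩, ?_, ?_⟩
  · have hli : LinearIndependent F4 ![u, v] := by
      rw [LinearIndependent.pair_iff]
      intro a b hab
      by_contra h
      have := hwt_ge a b h
      rw [hab, hwt_zero] at this
      omega
    rw [← Matrix.range_cons_cons_empty u v ![], finrank_span_eq_card hli, Fintype.card_fin]
  · intro x hx hx0
    obtain ⟨a, b, rfl⟩ := hmem.1 hx
    refine hwt_ge a b ?_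
    rintro ⟨rfl, rfl⟩
    simp at hx0
  · exact hmem.2 ⟨-1, 1, by module⟩
  · intro h
    have := hwc (one_ne_zero (α := F4))
    rw [h, hwt_zero] at this
    omega
  · refine eq_bot_iff.2 fun x hx => ?_
    obtain ⟨a, b, rfl⟩ := hmem.1 hx.1
    have h1 := hx.2 u (Submodule.subset_span (by simp))
    have h2 := hx.2 v (Submodule.subset_span (by simp))
    rw [hermInner_add_left, hermInner_smul_left, hermInner_smul_left, hself hwu,
      ← hermInner_conj u v, huv] at h1
    rw [hermInner_add_left, hermInner_smul_left, hermInner_smul_left, hself hwv, huv] at h2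
    have ha : a = 0 := by simpa using h1
    have hb : b = 0 := by simpa using h2
    simp [ha, hb]
  · rw [optimalDist, if_pos (by omega)]
    omega

/-- for every `m ≥ 0` there exists an optimal Hermitian LCD
`[5m + 3, 2, 4m + 2]` code, and it is unique up to equivalence. -/
theorem stmt12 (m : ℕ) :
    (∃ C : Submodule F4 (Fin (5 * m + 3) → F4), IsOptimalLCD (5 * m + 3) (4 * m + 2) C) ∧
    ∀ C C' : Submodule F4 (Fin (5 * m + 3) → F4),
      IsOptimalLCD (5 * m + 3) (4 * m + 2) C → IsOptimalLCD (5 * m + 3) (4 * m + 2) C' →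
        codeEquiv C C' := by
  refine ⟨exists_isOptimalLCD m, fun C C' hC hC' => ?_⟩
  obtain ⟨u, v, rfl, huv, hu, hv⟩ := hC.exists_normal_form
  obtain ⟨u', v', rfl, huv', hu', hv'⟩ := hC'.exists_normal_form
  exact codeEquiv_span_pair huv huv' (hu.trans hu'.symm) fun x => (hv x).trans (hv' x).symm
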